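/- arXiv:math/0403277 — 3 statements merged into one kernel-verified Lean document; each statement's English description precedes it below -/
import Mathlib

section
/- Assume the standing hypothesis on λ, β (with 0 ≤ k ≤ l−1, L = ρ+lμ, M = L + |λ|) and suppose β_{L+1} = 0. Then β = λ (λ padded with zeros to length M). -/
open Finset

/-- The partition `Λ(μ,s,l,ρ,m)` as a 1-based function, padded with zeros:
`ρ` parts equal to `m(s+l+1)` followed by, for `i = l, l-1, …, 1`, `μ` parts
equal to `m(s+i)`. -/
def Lam1 (μ s l ρ m : ℕ) : ℕ → ℕ := fun i =>
  if i = 0 then 0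
  else if i ≤ ρ then m * (s + l + 1)
  else if i ≤ ρ + l * μ then m * (s + l - (i - ρ - 1) / μ)
  else 0

/-- `λ = Λ(μ,s,l,ρ,m) - ε(ρ+kμ)`: subtract 1 from part number `ρ+kμ` (1-based). -/
def lamK (μ s l ρ m k : ℕ) : ℕ → ℕ := fun i =>
  if i = ρ + k * μ then Lam1 μ s l ρ m i - 1 else Lam1 μ s l ρ m i

/-- The rank `r(α,i) = #{j : α_j > α_i} + #{j : 1 ≤ j ≤ i, α_j = α_i}` of a
composition `α ∈ ℕ₀^M` (1-based). -/
def rank (M : ℕ) (α : ℕ → ℕ) (i : ℕ) : ℕ :=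
  ((Finset.Icc 1 M).filter fun j => α i < α j).card +
  ((Finset.Icc 1 i).filter fun j => α j = α i).card

/-- partial sum `Σ_{i=1}^{j} α_i`. -/
def psum (α : ℕ → ℕ) (j : ℕ) : ℕ := ∑ i ∈ Finset.Icc 1 j, α i

/-- `ℓ(α) = max{j : α_j > 0}` for a composition in `ℕ₀^M`. -/
def lenOf (M : ℕ) (α : ℕ → ℕ) : ℕ := ((Finset.Icc 1 M).filter fun j => α j ≠ 0).sup id

/-- the decreasing rearrangement `α⁺` of `(α_1, …, α_M)`, as a 1-based function. -/
def decRe (M : ℕ) (α : ℕ → ℕ) : ℕ → ℕ := fun i =>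
  (List.insertionSort (· ≥ ·) ((List.range M).map fun j => α (j + 1))).getD (i - 1) 0

/-- `α ⪰ β`: all partial sums of `α` dominate those of `β`. -/
def domsWeak (M : ℕ) (α β : ℕ → ℕ) : Prop :=
  ∀ j ∈ Finset.Icc 1 M, psum β j ≤ psum α j

/-- `α ≻ β`: `α ≠ β` and all partial sums of `α` dominate those of `β`. -/
def doms (M : ℕ) (α β : ℕ → ℕ) : Prop :=
  (∃ i ∈ Finset.Icc 1 M, α i ≠ β i) ∧ domsWeak M α β

/-- `α ▷ β`: `|α| = |β|` and either `α⁺ ≻ β⁺`, or `α⁺ = β⁺` and `α ≻ β`. -/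
def trig (M : ℕ) (α β : ℕ → ℕ) : Prop :=
  psum α M = psum β M ∧
  (doms M (decRe M α) (decRe M β) ∨
    ((∀ i ∈ Finset.Icc 1 M, decRe M α i = decRe M β i) ∧ doms M α β))

/-- `α ⊵ β`: `α ▷ β` or `α = β`. -/
def trigeq (M : ℕ) (α β : ℕ → ℕ) : Prop :=
  trig M α β ∨ ∀ i ∈ Finset.Icc 1 M, α i = β i

/-- The cells `I_0 = [1,ρ]` and `I_j = [ρ+(j-1)μ+1, ρ+jμ]` for `j ≥ 1`. -/
def cellI (ρ μ : ℕ) (j : ℕ) : Finset ℕ :=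
  if j = 0 then Finset.Icc 1 ρ else Finset.Icc (ρ + (j - 1) * μ + 1) (ρ + j * μ)

section Ranking

variable {L : ℕ} {τ b : ℕ → ℕ}

theorem exists_rank_eq (hτ : ∀ g < L, 1 ≤ τ g ∧ τ g ≤ L)
    (hinj : ∀ g < L, ∀ h < L, τ g = τ h → g = h) {t : ℕ} (ht1 : 1 ≤ t) (htL : t ≤ L) :
    ∃ g < L, τ g = t := by
  have himg : (range L).image τ = Icc 1 L := by
    apply eq_of_subset_of_card_le
    · intro t ht
      obtain ⟨g, hg, rfl⟩ := mem_image.1 ht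
      exact mem_Icc.2 (hτ g (mem_range.1 hg))
    · rw [card_image_of_injOn]
      · simp
      · intro g hg h hh
        exact hinj g (mem_range.1 hg) h (mem_range.1 hh)
  have : t ∈ (range L).image τ := himg ▸ mem_Icc.2 ⟨ht1, htL⟩
  obtain ⟨g, hg, h⟩ := mem_image.1 this
  exact ⟨g, mem_range.1 hg, h⟩

theorem card_rank_le (hτ : ∀ g < L, 1 ≤ τ g ∧ τ g ≤ L)
    (hinj : ∀ g < L, ∀ h < L, τ g = τ h → g = h) {t : ℕ} (htL : t ≤ L) :
    #{g ∈ range L | τ g ≤ t} = t := by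
  have himg : ({g ∈ range L | τ g ≤ t}).image τ = Icc 1 t := by
    ext u
    simp only [mem_image, mem_filter, mem_range, mem_Icc]
    constructor
    · rintro ⟨g, ⟨hg, hgt⟩, rfl⟩
      exact ⟨(hτ g hg).1, hgt⟩
    · rintro ⟨h1, h2⟩
      obtain ⟨g, hg, rfl⟩ := exists_rank_eq hτ hinj h1 (h2.trans htL)
      exact ⟨g, ⟨hg, h2⟩, rfl⟩
  have := congrArg card himg
  rw [card_image_of_injOn] at this
  · simpa using this
  · intro g hg h hh
    simp only [coe_filter, mem_range, Set.mem_ofPred_eq] at hg hh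
    exact hinj g hg.1 h hh.1

theorem rank_le_card_filter (hτ : ∀ g < L, 1 ≤ τ g ∧ τ g ≤ L)
    (hinj : ∀ g < L, ∀ h < L, τ g = τ h → g = h)
    (hlt : ∀ y < L, ∀ z < L, b z < b y → τ y < τ z) {g x : ℕ} (hg : g < L) (hx : x ≤ b g) :
    τ g ≤ #{z ∈ range L | x ≤ b z} := by
  rw [← card_rank_le hτ hinj (hτ g hg).2]
  apply card_le_card
  intro z hz
  simp only [mem_filter, mem_range] at hz ⊢
  refine ⟨hz.1, ?_⟩
  by_contra hzx
  have := hlt g hg z hz.1 (by omega)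
  omega

theorem card_lt_rank (hτ : ∀ g < L, 1 ≤ τ g ∧ τ g ≤ L)
    (hinj : ∀ g < L, ∀ h < L, τ g = τ h → g = h)
    (hlt : ∀ y < L, ∀ z < L, b z < b y → τ y < τ z) {g x : ℕ} (hg : g < L) (hx : b g < x) :
    #{z ∈ range L | x ≤ b z} < τ g := by
  have hb := hτ g hg
  have : #{z ∈ range L | x ≤ b z} ≤ #{z ∈ range L | τ z ≤ τ g - 1} := by
    apply card_le_card
    intro z hz
    simp only [mem_filter, mem_range] at hz ⊢
    have := hlt z hz.1 g hg (by omega)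
    exact ⟨hz.1, by omega⟩
  rw [card_rank_le hτ hinj (by omega)] at this
  omega

end Ranking

section Columns

variable {μ L p : ℕ} {τ b : ℕ → ℕ}

/-- Two entries in the same residue class mod `μ` with the same value: the larger index is `p`. -/
theorem eq_exceptional_of_same_column
    (heq : ∀ g < L, τ g + (μ + 1) * b g + g % μ = L + g / μ)
    (htie : ∀ y < L, ∀ z < L, b y = b z → z < y → y ≠ p → τ y < τ z)
    {y z : ℕ} (hy : y < L) (hb : b y = b z) (hmod : y % μ = z % μ) (hzy : z < y) :
    y = p := by
  by_contra hp
  have hz := hzy.trans hy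
  have h1 := htie y hy z hz hb hzy hp
  have h2 := heq y hy
  have h3 := heq z hz
  rw [hb, hmod] at h2
  have h4 : z / μ ≤ y / μ := Nat.div_le_div_right hzy.le
  omega

theorem card_le_of_not_exceptional (hμ : 0 < μ)
    (heq : ∀ g < L, τ g + (μ + 1) * b g + g % μ = L + g / μ)
    (htie : ∀ y < L, ∀ z < L, b y = b z → z < y → y ≠ p → τ y < τ z)
    {S : Finset ℕ} (hS : ∀ g ∈ S, g < L ∧ g ≠ p) {x y : ℕ} (hSb : ∀ g ∈ S, y ≤ b g ∧ b g < x) :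
    #S ≤ μ * (x - y) := by
  have : #S ≤ #(range μ ×ˢ Ico y x) := by
    apply card_le_card_of_injOn (fun g => (g % μ, b g))
    · intro g hg
      have := hSb g hg
      simp only [coe_product, Set.mem_prod, coe_range, Set.mem_Iio, coe_Ico, Set.mem_Ico]
      exact ⟨Nat.mod_lt _ hμ, this⟩
    · intro g hg h hh hgh
      simp only [Prod.mk.injEq] at hgh
      rcases lt_trichotomy g h with hlt | rfl | hlt
      · exact absurd (eq_exceptional_of_same_column heq htie (hS h hh).1 hgh.2.symm
          hgh.1.symm hlt) (hS h hh).2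
      · rfl
      · exact absurd (eq_exceptional_of_same_column heq htie (hS g hg).1 hgh.2
          hgh.1 hlt) (hS g hg).2
  simpa using this

theorem card_le_add_one (hμ : 0 < μ)
    (heq : ∀ g < L, τ g + (μ + 1) * b g + g % μ = L + g / μ)
    (htie : ∀ y < L, ∀ z < L, b y = b z → z < y → y ≠ p → τ y < τ z)
    {S : Finset ℕ} (hS : ∀ g ∈ S, g < L) {x y : ℕ} (hSb : ∀ g ∈ S, y ≤ b g ∧ b g < x) :
    #S ≤ μ * (x - y) + 1 := by
  have h := card_le_of_not_exceptional hμ heq htie (S := S.erase p)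
    (fun g hg => ⟨hS g (mem_of_mem_erase hg), ne_of_mem_erase hg⟩)
    (fun g hg => hSb g (mem_of_mem_erase hg))
  have := pred_card_le_card_erase (a := p) (s := S)
  omega

/-- A column meets `[0, (Q + 1) * μ)` in at most `Q + 1` points. -/
theorem card_column_le {S : Finset ℕ} {Q r : ℕ}
    (hS : ∀ g ∈ S, g / μ ≤ Q ∧ g % μ = r) : #S ≤ Q + 1 := by
  rw [← card_range (Q + 1)]
  apply card_le_card_of_injOn (fun g => g / μ)
  · intro g hg
    have := (hS g hg).1
    simp only [coe_range, Set.mem_Iio]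
    omega
  · intro g hg h hh hgh
    have h1 := (hS g hg).2
    have h2 := (hS h hh).2
    simp only at hgh
    rw [← Nat.div_add_mod g μ, ← Nat.div_add_mod h μ, h1, h2, hgh]

theorem block_step (hμ : 0 < μ)
    (hτ : ∀ g < L, 1 ≤ τ g ∧ τ g ≤ L)
    (hinj : ∀ g < L, ∀ h < L, τ g = τ h → g = h)
    (heq : ∀ g < L, τ g + (μ + 1) * b g + g % μ = L + g / μ)
    (hlt : ∀ y < L, ∀ z < L, b z < b y → τ y < τ z)
    (htie : ∀ y < L, ∀ z < L, b y = b z → z < y → y ≠ p → τ y < τ z)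
    {Q : ℕ} (hQ : Q * μ < L)
    (hdone : ∀ g < L, Q < g / μ → b g = g / μ)
    (hrest : ∀ g < L, g / μ ≤ Q → b g ≤ Q) :
    (∀ g < L, g / μ = Q → b g = Q) ∧ ∀ g < L, g / μ < Q → b g < Q := by
  have hcompl : ∀ x, #{z ∈ range L | x ≤ b z} + #{z ∈ range L | b z < x} = L := by
    intro x
    have := card_filter_add_card_filter_not (s := range L) (fun z => x ≤ b z)
    simpa using this
  have hblock : ∀ g < L, Q < b g ↔ Q < g / μ := by
    intro g hg
    constructor
    · intro h
      by_contra h'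
      have := hrest g hg (by omega)
      omega
    · intro h
      rw [hdone g hg h]; exact h
  have hdivlt : ∀ g, Q < g / μ ↔ (Q + 1) * μ ≤ g := by
    intro g
    rw [← Nat.le_div_iff_mul_le hμ]; rfl
  have htop : #{z ∈ range L | Q + 1 ≤ b z} = L - (Q + 1) * μ := by
    rw [← Nat.card_Ico]
    congr 1
    ext g
    simp only [mem_filter, mem_range, mem_Ico]
    constructor
    · rintro ⟨h1, h2⟩
      exact ⟨(hdivlt g).1 ((hblock g h1).1 h2), h1⟩
    · rintro ⟨h1, h2⟩
      exact ⟨h2, (hblock g h2).2 ((hdivlt g).2 h1)⟩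
  have hsucc : (Q + 1) * μ = Q * μ + μ := by ring
  -- the number of entries with value at least `Q`
  have hcard : #{z ∈ range L | Q ≤ b z} = L - Q * μ := by
    apply le_antisymm
    · by_contra hgt
      have hle := hcompl Q
      obtain ⟨y, hy, hyr⟩ := exists_rank_eq hτ hinj
        (t := #{z ∈ range L | Q ≤ b z}) (by omega) (by omega)
      have hb1 : Q ≤ b y := by
        by_contra h
        have := card_lt_rank hτ hinj hlt hy (x := Q) (by omega)
        omega
      have hb2 : b y ≤ Q := by
        by_contra h
        have := rank_le_card_filter hτ hinj hlt hy (x := Q + 1) (by omega)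
        omega
      have hq : y / μ ≤ Q := by
        by_contra h
        have := (hblock y hy).2 (by omega)
        omega
      have h := heq y hy
      rw [show b y = Q by omega, show (μ + 1) * Q = Q * μ + Q by ring] at h
      omega
    · have h := heq (Q * μ) hQ
      rw [Nat.mul_mod_left, Nat.mul_div_cancel _ hμ] at h
      have hby := hrest (Q * μ) hQ (by rw [Nat.mul_div_cancel _ hμ])
      have hr := rank_le_card_filter hτ hinj hlt hQ (le_refl (b (Q * μ)))
      generalize b (Q * μ) = y at *
      obtain ⟨d, rfl⟩ := Nat.exists_eq_add_of_le hby
      rcases Nat.eq_zero_or_pos d with rfl | hd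
      · simp only [add_zero] at *
        have : (μ + 1) * y = y * μ + y := by ring
        omega
      · have h1 := hcompl y
        have h2 := hcompl (y + d)
        have h3 : #{z ∈ range L | b z < y + d} ≤
            #{z ∈ range L | b z < y} + #{z ∈ range L | y ≤ b z ∧ b z < y + d} := by
          rw [← card_union_of_disjoint]
          · apply card_le_card
            intro g
            simp only [mem_filter, mem_range, mem_union]
            omega
          · rw [disjoint_filter]
            omega
        have h4 := card_le_add_one hμ heq htie
          (S := {z ∈ range L | y ≤ b z ∧ b z < y + d}) (x := y + d) (y := y)
          (by simp +contextual) (by simp +contextual)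
        have e1 : (μ + 1) * y = y * μ + y := by ring
        have e2 : (y + d) * μ = y * μ + μ * d := by ring
        have e3 : y + d - y = d := by omega
        rw [e3] at h4
        omega
  -- no column contains the value `Q` twice
  have hnodup : ∀ y < L, ∀ z < L, b y = Q → b z = Q → y % μ = z % μ → ¬ z < y := by
    intro y hy z hz hby hbz hmod hzy
    have hyp := eq_exceptional_of_same_column heq htie hy (hby.trans hbz.symm) hmod hzy
    have hV : #{g ∈ range L | b g < Q} = Q * μ := by
      have := hcompl Q
      omega
    have hfib : #{g ∈ range L | b g < Q} =
        ∑ r ∈ range μ, #{g ∈ {g ∈ range L | b g < Q} | g % μ = r} :=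
      card_eq_sum_card_fiberwise (fun g _ => by
        simpa using Nat.mod_lt g hμ)
    have hlt' : ∑ r ∈ range μ, #{g ∈ {g ∈ range L | b g < Q} | g % μ = r} <
        ∑ r ∈ range μ, Q := by
      apply sum_lt_sum
      · intro r hr
        refine le_of_le_of_eq ?_ (card_range Q)
        apply card_le_card_of_injOn b
        · intro g hg
          simp only [mem_coe, mem_filter] at hg
          simpa using hg.1.2
        · intro g hg h hh hgh
          simp only [mem_coe, mem_filter, mem_range] at hg hh
          rcases lt_trichotomy g h with hl | rfl | hl
          · have := eq_exceptional_of_same_column heq htie hh.1.1 hgh.symm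
              (hh.2.trans hg.2.symm) hl
            rw [this.trans hyp.symm] at hh
            omega
          · rfl
          · have := eq_exceptional_of_same_column heq htie hg.1.1 hgh
              (hg.2.trans hh.2.symm) hl
            rw [this.trans hyp.symm] at hg
            omega
      · refine ⟨y % μ, mem_range.2 (Nat.mod_lt _ hμ), ?_⟩
        have hle : ∀ g < L, b g ≤ Q → g / μ ≤ Q := by
          intro g hg hbg
          by_contra h
          have := (hblock g hg).2 (by omega)
          omega
        have hz' : z ∉ ({g ∈ {g ∈ range L | b g < Q} | g % μ = y % μ}) := by
          simp only [mem_filter]; omega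
        have hy' : y ∉ insert z ({g ∈ {g ∈ range L | b g < Q} | g % μ = y % μ}) := by
          simp only [mem_filter, mem_insert]; omega
        have := card_column_le (Q := Q) (r := y % μ)
          (S := insert y (insert z ({g ∈ {g ∈ range L | b g < Q} | g % μ = y % μ}))) (by
            intro g hg
            simp only [mem_insert, mem_filter, mem_range] at hg
            rcases hg with rfl | rfl | ⟨⟨h1, h2⟩, h3⟩
            · exact ⟨hle _ hy hby.le, rfl⟩
            · exact ⟨hle _ hz hbz.le, hmod.symm⟩
            · exact ⟨hle _ h1 h2.le, h3⟩)
        rw [card_insert_of_notMem hy', card_insert_of_notMem hz'] at this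
        omega
    simp only [sum_const, card_range, smul_eq_mul] at hlt'
    rw [← hfib, hV, mul_comm] at hlt'
    exact lt_irrefl _ hlt'
  have hvalue : ∀ y < L, L - (Q + 1) * μ < τ y → τ y ≤ L - Q * μ → b y = Q := by
    intro y hy h1 h2
    apply le_antisymm
    · by_contra h
      have := rank_le_card_filter hτ hinj hlt hy (x := Q + 1) (by omega)
      omega
    · by_contra h
      have := card_lt_rank hτ hinj hlt hy (x := Q) (by omega)
      omega
  have hfix : ∀ r < μ, Q * μ + r < L → b (Q * μ + r) = Q ∧ τ (Q * μ + r) = L - (Q * μ + r) := by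
    intro r
    induction r using Nat.strong_induction_on with
    | _ r ih =>
      intro hr hrL
      obtain ⟨y, hy, hyr⟩ := exists_rank_eq hτ hinj
        (t := L - (Q * μ + r)) (by omega) (by omega)
      have hby := hvalue y hy (by omega) (by omega)
      have h := heq y hy
      have hq : y / μ ≤ Q := by
        by_contra h
        have := (hblock y hy).2 (by omega)
        omega
      have e1 : (μ + 1) * Q = Q * μ + Q := by ring
      have hdm := Nat.div_add_mod y μ
      rw [hby, e1] at h
      rcases hq.lt_or_eq with hq | hq
      · exfalso
        have hm := Nat.mod_lt y hμ
        have h1 := ih (y % μ) (by omega) hm (by omega)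
        refine hnodup (Q * μ + y % μ) (by omega) y hy h1.1 hby ?_ ?_
        · rw [mul_comm Q, Nat.mul_add_mod, Nat.mod_mod]
        · have : μ * (y / μ) < Q * μ := by
            rw [mul_comm Q]; exact Nat.mul_lt_mul_of_pos_left hq hμ
          omega
      · have : y = Q * μ + r := by
          rw [hq, mul_comm μ] at hdm
          omega
        subst this
        exact ⟨hby, hyr⟩
  have hform : ∀ g, g / μ = Q → g = Q * μ + g % μ := by
    intro g hg
    have := Nat.div_add_mod g μ
    rw [hg, mul_comm] at this
    exact this.symm
  constructor
  · intro g hg hgQ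
    have h1 := hform g hgQ
    have := hfix (g % μ) (Nat.mod_lt _ hμ) (by omega)
    rw [h1]; exact this.1
  · intro g hg hgQ
    refine lt_of_le_of_ne (hrest g hg hgQ.le) fun hbg => ?_
    have h1 := rank_le_card_filter hτ hinj hlt hg (x := Q) hbg.ge
    have h2 := card_lt_rank hτ hinj hlt hg (x := Q + 1) (by omega)
    have h3 := hτ g hg
    have h4 := hfix (L - τ g - Q * μ) (by omega) (by omega)
    have h5 := hinj g hg _ (by omega) (show τ g = τ (Q * μ + (L - τ g - Q * μ)) by omega)
    have h6 : Q ≤ g / μ := (Nat.le_div_iff_mul_le hμ).2 (by omega)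
    omega

theorem value_eq_div {l : ℕ} (hμ : 0 < μ) (hL1 : l * μ < L) (hL2 : L ≤ (l + 1) * μ)
    (hτ : ∀ g < L, 1 ≤ τ g ∧ τ g ≤ L)
    (hinj : ∀ g < L, ∀ h < L, τ g = τ h → g = h)
    (heq : ∀ g < L, τ g + (μ + 1) * b g + g % μ = L + g / μ)
    (hlt : ∀ y < L, ∀ z < L, b z < b y → τ y < τ z)
    (htie : ∀ y < L, ∀ z < L, b y = b z → z < y → y ≠ p → τ y < τ z) :
    ∀ g < L, b g = g / μ := by
  have key : ∀ j ≤ l + 1, (∀ g < L, l + 1 - j ≤ g / μ → b g = g / μ) ∧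
      ∀ g < L, g / μ < l + 1 - j → b g < l + 1 - j := by
    intro j
    induction j with
    | zero =>
      intro _
      have hdiv : ∀ g < L, g / μ < l + 1 := fun g hg =>
        (Nat.div_lt_iff_lt_mul hμ).2 (by omega)
      refine ⟨fun g hg h => ?_, fun g hg _ => ?_⟩
      · have := hdiv g hg
        omega
      · by_contra h
        have h1 := heq g hg
        have h2 := hτ g hg
        have h3 : (μ + 1) * (l + 1) ≤ (μ + 1) * b g := Nat.mul_le_mul_left _ (by omega)
        have h4 : (μ + 1) * (l + 1) = (l + 1) * μ + (l + 1) := by ring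
        have := hdiv g hg
        omega
    | succ j ih =>
      intro hj
      obtain ⟨ih1, ih2⟩ := ih (by omega)
      have hsub : l + 1 - j = (l + 1 - (j + 1)) + 1 := by omega
      have hQl : l + 1 - (j + 1) ≤ l := by omega
      rw [hsub] at ih1 ih2
      generalize l + 1 - (j + 1) = Q at *
      obtain ⟨h1, h2⟩ := block_step hμ hτ hinj heq hlt htie
        (lt_of_le_of_lt (Nat.mul_le_mul_right μ hQl) hL1)
        (fun g hg h => ih1 g hg h)
        (fun g hg h => Nat.lt_succ_iff.1 (ih2 g hg (Nat.lt_succ_iff.2 h)))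
      refine ⟨fun g hg h => ?_, h2⟩
      rcases h.eq_or_lt with h | h
      · rw [h1 g hg h.symm, h]
      · exact ih1 g hg h
  intro g hg
  exact (key (l + 1) le_rfl).1 g hg (by simp)

end Columns

section Lambda

variable {μ s l ρ m k : ℕ}

theorem Lam1_sub (hμ : 1 ≤ μ) (hρμ : ρ ≤ μ) {g : ℕ} (hg : g < ρ + l * μ) :
    Lam1 μ s l ρ m (ρ + l * μ - g) = m * (s + 1 + g / μ) := by
  unfold Lam1
  rw [if_neg (by omega)]
  split_ifs with h1 h2
  · have : g / μ = l := by
      apply Nat.div_eq_of_lt_le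
      · omega
      · have : (l + 1) * μ = l * μ + μ := by ring
        omega
    rw [this]; ring
  · have hdm := Nat.div_add_mod g μ
    have hm := Nat.mod_lt g hμ
    generalize g / μ = q at *
    generalize g % μ = r at *
    have hql : q < l := by
      by_contra h
      have : μ * l ≤ μ * q := Nat.mul_le_mul_left _ (by omega)
      rw [mul_comm μ l] at this
      omega
    obtain ⟨d, rfl⟩ := Nat.exists_eq_add_of_lt hql
    have : (ρ + (q + d + 1) * μ - g - ρ - 1) / μ = d := by
      have e : (q + d + 1) * μ = μ * q + d * μ + μ := by ring
      apply Nat.div_eq_of_lt_le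
      · omega
      · have : (d + 1) * μ = d * μ + μ := by ring
        omega
    rw [this]
    congr 1
    omega
  · omega

theorem lamK_sub (hμ : 1 ≤ μ) (hρμ : ρ ≤ μ) (hk : k ≤ l) {g : ℕ} (hg : g < ρ + l * μ) :
    lamK μ s l ρ m k (ρ + l * μ - g) =
      m * (s + 1 + g / μ) - if g = (l - k) * μ then 1 else 0 := by
  have hkl : (l - k) * μ + k * μ = l * μ := by
    rw [← add_mul, Nat.sub_add_cancel hk]
  unfold lamK
  rw [Lam1_sub hμ hρμ hg]
  split_ifs with h1 h2 h2
  · rfl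
  · omega
  · omega
  · rfl

theorem lamK_eq_zero (hk : k ≤ l) {i : ℕ} (hi : ρ + l * μ < i) : lamK μ s l ρ m k i = 0 := by
  have : k * μ ≤ l * μ := Nat.mul_le_mul_right _ hk
  unfold lamK Lam1
  rw [if_neg (by omega), if_neg (by omega), if_neg (by omega), if_neg (by omega)]

end Lambda

section Rank

variable {M : ℕ} {α : ℕ → ℕ}

theorem rank_lt_rank {i j : ℕ} (hi : i ∈ Icc 1 M) (hj : j ∈ Icc 1 M)
    (h : α j < α i ∨ α i = α j ∧ i < j) : rank M α i < rank M α j := by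
  rw [mem_Icc] at hi hj
  have hdisj : ∀ n, Disjoint {a ∈ Icc 1 M | α n < α a} {a ∈ Icc 1 n | α a = α n} := by
    intro n
    rw [disjoint_left]
    simp only [mem_filter]
    omega
  unfold rank
  rw [← card_union_of_disjoint (hdisj i), ← card_union_of_disjoint (hdisj j)]
  apply card_lt_card
  rw [ssubset_iff_of_subset]
  · refine ⟨j, ?_, ?_⟩
    · simp [hj.1]
    · simp only [mem_union, mem_filter, mem_Icc]
      omega
  · intro a
    simp only [mem_union, mem_filter, mem_Icc]
    omega

theorem one_le_rank {i : ℕ} (hi : 1 ≤ i) : 1 ≤ rank M α i := by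
  have : 0 < #{j ∈ Icc 1 i | α j = α i} :=
    card_pos.2 ⟨i, by simp [hi]⟩
  unfold rank
  omega

theorem rank_le_of_support {L i : ℕ} (h0 : ∀ j ∈ Icc 1 M, L < j → α j = 0) (hi : i ≤ L) :
    rank M α i ≤ L := by
  unfold rank
  rw [← card_union_of_disjoint]
  · refine (card_le_card (t := Icc 1 L) ?_).trans (by simp)
    intro a
    simp only [mem_union, mem_filter, mem_Icc]
    rintro (⟨h1, h2⟩ | h)
    · refine ⟨h1.1, ?_⟩
      by_contra h
      have := h0 a (mem_Icc.2 h1) (by omega)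
      omega
    · omega
  · rw [disjoint_left]
    simp only [mem_filter]
    omega

/-- A zero entry whose rank is its own position is followed by zeros only. -/
theorem eq_zero_of_rank_eq {i : ℕ} (hi : i ∈ Icc 1 M) (h0 : α i = 0) (hr : rank M α i = i) :
    ∀ j ∈ Icc 1 M, i < j → α j = 0 := by
  rw [mem_Icc] at hi
  intro j hj hij
  by_contra hne
  have hsub : Icc 1 i ⊆ ({a ∈ Icc 1 M | α i < α a} ∪ {a ∈ Icc 1 i | α a = α i}).erase j := by
    intro a
    simp only [mem_erase, mem_union, mem_filter, mem_Icc]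
    omega
  have hcard := card_le_card hsub
  rw [card_erase_of_mem, Nat.card_Icc] at hcard
  · have := card_union_le {a ∈ Icc 1 M | α i < α a} {a ∈ Icc 1 i | α a = α i}
    unfold rank at hr
    omega
  · rw [mem_union, mem_filter]
    exact Or.inl ⟨hj, by omega⟩

end Rank

/-- under the standing hypothesis on `λ = Λ(μ,s,l,ρ,m) - ε(ρ+kμ)` and
`β`, if `β_{L+1} = 0` then `β = λ` (padded with zeros to length `M`). -/
theorem beta_eq_lambda (μ s l ρ m k : ℕ) (β : ℕ → ℕ)
    (hμ : 1 ≤ μ) (hl : 1 ≤ l) (hρ1 : 1 ≤ ρ) (hρμ : ρ ≤ μ) (hm : 1 ≤ m)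
    (hgcd : Nat.gcd m (μ + 1) = 1) (hk : k ≤ l - 1)
    (L M : ℕ) (hL : L = ρ + l * μ) (hM : M = L + psum (lamK μ s l ρ m k) L)
    (hβ0 : ∀ i, M < i → β i = 0)
    (hdom : trigeq M (lamK μ s l ρ m k) β)
    (hrank : ∀ i ∈ Finset.Icc 1 M,
      (m : ℤ) * ((rank M β i : ℤ) - (i : ℤ)) =
        ((μ : ℤ) + 1) * ((lamK μ s l ρ m k i : ℤ) - (β i : ℤ)))
    (hβL : β (L + 1) = 0) :
    ∀ i ∈ Finset.Icc 1 M, β i = lamK μ s l ρ m k i := by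
  have hkl : k ≤ l := by omega
  have hlam0 : ∀ i, L < i → lamK μ s l ρ m k i = 0 := fun i hi =>
    lamK_eq_zero hkl (hL ▸ hi)
  have hlam : ∀ g < L, lamK μ s l ρ m k (L - g) =
      m * (s + 1 + g / μ) - if g = (l - k) * μ then 1 else 0 := by
    subst hL
    exact fun g hg => lamK_sub hμ hρμ hkl hg
  have hp : 0 < (l - k) * μ := Nat.mul_pos (by omega) hμ
  have hLM : L < M := by
    have h1 := hlam 0 (by omega)
    rw [if_neg (by omega)] at h1
    have h2 : lamK μ s l ρ m k L ≤ psum (lamK μ s l ρ m k) L :=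
      single_le_sum (f := lamK μ s l ρ m k) (fun _ _ => Nat.zero_le _)
        (mem_Icc.2 ⟨by omega, le_rfl⟩)
    have h3 : 0 < m * (s + 1 + 0 / μ) := Nat.mul_pos hm (by positivity)
    simp only [Nat.sub_zero] at h1
    omega
  have hmem : L + 1 ∈ Icc 1 M := mem_Icc.2 ⟨by omega, hLM⟩
  have hrL : rank M β (L + 1) = L + 1 := by
    have := hrank (L + 1) hmem
    rw [hlam0 (L + 1) (by omega), hβL] at this
    have hm0 : (m : ℤ) ≠ 0 := by positivity
    simp only [Nat.cast_zero, sub_self, mul_zero, mul_eq_zero, hm0, false_or] at this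
    omega
  have hβzero : ∀ j ∈ Icc 1 M, L < j → β j = 0 := by
    intro j hj hLj
    rcases (Nat.succ_le_of_lt hLj).eq_or_lt with h | h
    · rw [← h]; exact hβL
    · exact eq_zero_of_rank_eq hmem hβL hrL j hj h
  have hpos : ∀ g < L, L - g ∈ Icc 1 M := fun g hg => mem_Icc.2 (by omega)
  have hcop : IsCoprime (m : ℤ) ((μ : ℤ) + 1) := by
    have := Nat.isCoprime_iff_coprime.2 (show Nat.Coprime m (μ + 1) from hgcd)
    exact_mod_cast this
  have hstep : ∀ g < L, ∃ c : ℕ,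
      β (L - g) + (if g = (l - k) * μ then 1 else 0) = m * (s + 1 + c) ∧
      rank M β (L - g) + (μ + 1) * c + g % μ = L + g / μ := by
    intro g hg
    have h := hrank _ (hpos g hg)
    obtain ⟨t, ht⟩ : (m : ℤ) ∣ (lamK μ s l ρ m k (L - g) : ℤ) - β (L - g) :=
      hcop.dvd_of_dvd_mul_left ⟨_, h.symm⟩
    have ht' : (rank M β (L - g) : ℤ) - ((L - g : ℕ) : ℤ) = (μ + 1) * t := by
      have hm0 : (m : ℤ) ≠ 0 := by positivity
      apply mul_left_cancel₀ hm0
      rw [h, ht]; ring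
    have hr : rank M β (L - g) ≤ L := rank_le_of_support hβzero (Nat.sub_le _ _)
    have hval := hlam g hg
    have he : (if g = (l - k) * μ then 1 else 0) ≤ 1 := by split_ifs <;> omega
    have hdm := Nat.div_add_mod g μ
    have hmod := Nat.mod_lt g hμ
    generalize (if g = (l - k) * μ then 1 else 0) = e at *
    generalize g / μ = q at *
    generalize g % μ = r at *
    generalize rank M β (L - g) = R at *
    have hle : t ≤ q := by
      by_contra hlt
      have h1 : ((μ : ℤ) + 1) * (q + 1) ≤ (μ + 1) * t :=
        mul_le_mul_of_nonneg_left (by omega) (by omega)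
      have h2 : ((μ : ℤ) + 1) * (q + 1) = (μ * q : ℕ) + q + μ + 1 := by push_cast; ring
      omega
    obtain ⟨c, hc⟩ := Int.eq_ofNat_of_zero_le (sub_nonneg.2 hle)
    have ht2 : t = q - c := by omega
    refine ⟨c, ?_, ?_⟩
    · have : 0 < m * (s + 1 + q) := Nat.mul_pos hm (by omega)
      rw [hval, Nat.cast_sub (by omega), ht2] at ht
      zify
      push_cast at ht ⊢
      linear_combination -ht
    · rw [ht2, Nat.cast_sub hg.le] at ht'
      zify at hdm ⊢
      linear_combination ht' + hdm
  choose! b hβb heq using hstep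
  have hrl : ∀ y < L, ∀ z < L, β (L - z) < β (L - y) ∨ β (L - y) = β (L - z) ∧ z < y →
      rank M β (L - y) < rank M β (L - z) := fun y hy z hz h =>
    rank_lt_rank (hpos y hy) (hpos z hz) (by omega)
  have hlt : ∀ y < L, ∀ z < L, b z < b y → rank M β (L - y) < rank M β (L - z) := by
    intro y hy z hz hzy
    have h1 := hβb y hy
    have h2 := hβb z hz
    have h3 : m * (s + 1 + b z) + m ≤ m * (s + 1 + b y) := by
      rw [← Nat.mul_succ]
      exact Nat.mul_le_mul_left _ (by omega)
    by_contra hcon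
    have hnot : ¬ (β (L - z) < β (L - y) ∨ β (L - y) = β (L - z) ∧ z < y) :=
      fun h => hcon (hrl y hy z hz h)
    by_cases hyp : y = (l - k) * μ
    · have hyz : y < z := by
        have : y ≠ z := fun h => by rw [h] at hzy; omega
        rw [if_pos hyp] at h1
        split_ifs at h2 <;> omega
      have h4 := heq y hy
      have h5 := heq z hz
      have h6 := Nat.mod_lt z hμ
      have h7 : y / μ ≤ z / μ := Nat.div_le_div_right hyz.le
      have h8 : y % μ = 0 := by rw [hyp, Nat.mul_mod_left]
      have h9 : (μ + 1) * b z + (μ + 1) ≤ (μ + 1) * b y := by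
        rw [← Nat.mul_succ]
        exact Nat.mul_le_mul_left _ hzy
      omega
    · rw [if_neg hyp] at h1
      split_ifs at h2 <;> omega
  have htie : ∀ y < L, ∀ z < L, b y = b z → z < y → y ≠ (l - k) * μ →
      rank M β (L - y) < rank M β (L - z) := by
    intro y hy z hz hyz hlt hyp
    have h1 := hβb y hy
    have h2 := hβb z hz
    rw [if_neg hyp, hyz] at h1
    apply hrl y hy z hz
    split_ifs at h2 <;> omega
  have hinj : ∀ g < L, ∀ h < L, rank M β (L - g) = rank M β (L - h) → g = h := by
    intro g hg h hh hgh
    by_contra hne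
    have h1 := hrl g hg h hh
    have h2 := hrl h hh g hg
    omega
  have hb := value_eq_div (τ := fun g => rank M β (L - g)) (b := b) (l := l) hμ (by omega)
    (by rw [add_mul]; omega)
    (fun g hg => ⟨one_le_rank (by omega), rank_le_of_support hβzero (Nat.sub_le _ _)⟩)
    hinj heq hlt htie
  intro i hi
  rcases le_or_gt i L with hiL | hiL
  · have hi1 := (mem_Icc.1 hi).1
    have h1 := hβb (L - i) (by omega)
    have h2 := hlam (L - i) (by omega)
    rw [hb (L - i) (by omega), Nat.sub_sub_self hiL] at h1
    rw [Nat.sub_sub_self hiL] at h2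
    omega
  · rw [hβzero i hi hiL, hlam0 i hiL]
end

section
/- Let σ and τ be partitions of the same positive integer n with σ ≺ τ (i.e., σ ≠ τ and Σ_{i=1}^{j} σ_i ≤ Σ_{i=1}^{j} τ_i for every j). Then the content sums satisfy Σ_{i≥1} Σ_{j=1}^{σ_i} (j−i) < Σ_{i≥1} Σ_{j=1}^{τ_i} (j−i); equivalently σ(ω) > τ(ω), where for a partition π of n one sets π(ω) = C(n,2) − Σ_{i≥1} Σ_{j=1}^{π_i} (j−i). -/
open Finset

/-- The contents in row `i` of length `m` sum to `(m (m + 1) - 2 i m) / 2`. -/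
theorem two_mul_sum_row_content (m : ℕ) (i : ℤ) :
    2 * ∑ j ∈ Finset.Icc 1 m, ((j : ℤ) - i) = m * (m + 1) - 2 * i * m := by
  induction m with
  | zero => simp
  | succ k ih =>
    rw [Finset.sum_Icc_succ_top (by omega), mul_add, ih]
    push_cast
    ring

/-- A one-sided Abel summation bound: if the partial sums of `d` are nonnegative and `c` drops by
at least `2` at each step, then `∑ d i * c i` is bounded below in terms of the partial sums. -/
theorem partial_sums_le_sum_mul (d c : ℕ → ℤ) (n : ℕ)
    (hd : ∀ j ∈ Finset.Icc 1 n, 0 ≤ ∑ i ∈ Finset.Icc 1 j, d i)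
    (hc : ∀ i, 1 ≤ i → c (i + 1) + 2 ≤ c i) :
    (∑ i ∈ Finset.Icc 1 n, d i) * c (n + 1) +
      2 * ∑ j ∈ Finset.Icc 1 n, ∑ i ∈ Finset.Icc 1 j, d i ≤ ∑ i ∈ Finset.Icc 1 n, d i * c i := by
  induction n with
  | zero => simp
  | succ k ih =>
    have hk := ih fun j hj => hd j (by simp only [Finset.mem_Icc] at hj ⊢; omega)
    have hD := mul_le_mul_of_nonneg_left (hc (k + 1) (by omega)) (hd (k + 1) (by simp))
    rw [Finset.sum_Icc_succ_top (by omega) (fun j => ∑ i ∈ Finset.Icc 1 j, d i),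
      Finset.sum_Icc_succ_top (by omega) (fun i => d i * c i)]
    rw [Finset.sum_Icc_succ_top (by omega)] at hD ⊢
    linarith

/-- A sequence whose partial sums all vanish is zero. -/
theorem eq_zero_of_partial_sums_eq_zero (d : ℕ → ℤ) (n : ℕ)
    (hd : ∀ j ∈ Finset.Icc 1 n, ∑ i ∈ Finset.Icc 1 j, d i = 0) :
    ∀ i ∈ Finset.Icc 1 n, d i = 0 := by
  intro i hi
  obtain ⟨k, rfl⟩ : ∃ k, i = k + 1 := ⟨i - 1, by simp only [Finset.mem_Icc] at hi; omega⟩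
  have h := hd _ hi
  rw [Finset.sum_Icc_succ_top (by omega)] at h
  rcases Nat.eq_zero_or_pos k with rfl | hk
  · simpa using h
  · rwa [hd k (by simp only [Finset.mem_Icc] at hi ⊢; omega), zero_add] at h

/-- if `σ ≺ τ` are distinct partitions of the same positive integer `n`
(so `σ ≠ τ` and all partial sums of `σ` are dominated by those of `τ`), then the
content sums satisfy `Σ_{(i,j)∈σ} (j-i) < Σ_{(i,j)∈τ} (j-i)`; equivalently
`σ(ω) > τ(ω)` where `π(ω) = C(n,2) - Σ_{(i,j)∈π} (j-i)`. -/
theorem content_sum_strict_mono (n : ℕ) (hn : 0 < n) (σ τ : ℕ → ℕ)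
    (hσdec : ∀ i, 1 ≤ i → σ (i + 1) ≤ σ i) (hτdec : ∀ i, 1 ≤ i → τ (i + 1) ≤ τ i)
    (hσ0 : ∀ i, n < i → σ i = 0) (hτ0 : ∀ i, n < i → τ i = 0)
    (hσsum : ∑ i ∈ Finset.Icc 1 n, σ i = n) (hτsum : ∑ i ∈ Finset.Icc 1 n, τ i = n)
    (hne : ∃ i ∈ Finset.Icc 1 n, σ i ≠ τ i)
    (hdom : ∀ j ∈ Finset.Icc 1 n,
      ∑ i ∈ Finset.Icc 1 j, σ i ≤ ∑ i ∈ Finset.Icc 1 j, τ i) :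
    (∑ i ∈ Finset.Icc 1 n, ∑ j ∈ Finset.Icc 1 (σ i), ((j : ℤ) - (i : ℤ))) <
      (∑ i ∈ Finset.Icc 1 n, ∑ j ∈ Finset.Icc 1 (τ i), ((j : ℤ) - (i : ℤ))) ∧
    ((n.choose 2 : ℤ) - ∑ i ∈ Finset.Icc 1 n, ∑ j ∈ Finset.Icc 1 (τ i), ((j : ℤ) - (i : ℤ))) <
      ((n.choose 2 : ℤ) - ∑ i ∈ Finset.Icc 1 n, ∑ j ∈ Finset.Icc 1 (σ i), ((j : ℤ) - (i : ℤ))) := by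
  have hD : ∀ j ∈ Finset.Icc 1 n, 0 ≤ ∑ i ∈ Finset.Icc 1 j, ((τ i : ℤ) - σ i) := by
    intro j hj
    rw [Finset.sum_sub_distrib, sub_nonneg]
    exact_mod_cast hdom j hj
  have hDn : ∑ i ∈ Finset.Icc 1 n, ((τ i : ℤ) - σ i) = 0 := by
    rw [Finset.sum_sub_distrib, sub_eq_zero]
    exact_mod_cast hτsum.trans hσsum.symm
  have hpos : 0 < ∑ j ∈ Finset.Icc 1 n, ∑ i ∈ Finset.Icc 1 j, ((τ i : ℤ) - σ i) := by
    refine lt_of_le_of_ne (Finset.sum_nonneg hD) fun h => ?_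
    obtain ⟨i, hi, hne⟩ := hne
    have := eq_zero_of_partial_sums_eq_zero _ n
      ((Finset.sum_eq_zero_iff_of_nonneg hD).1 h.symm) i hi
    omega
  have habel := partial_sums_le_sum_mul (fun i => (τ i : ℤ) - σ i)
    (fun i => (τ i : ℤ) + σ i + 1 - 2 * i) n hD (by
      intro i hi
      have := hσdec i hi
      have := hτdec i hi
      push_cast
      omega)
  have hdiff : 2 * (∑ i ∈ Finset.Icc 1 n, ∑ j ∈ Finset.Icc 1 (τ i), ((j : ℤ) - (i : ℤ))) -
      2 * (∑ i ∈ Finset.Icc 1 n, ∑ j ∈ Finset.Icc 1 (σ i), ((j : ℤ) - (i : ℤ))) =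
      ∑ i ∈ Finset.Icc 1 n, ((τ i : ℤ) - σ i) * ((τ i : ℤ) + σ i + 1 - 2 * i) := by
    rw [Finset.mul_sum, Finset.mul_sum, ← Finset.sum_sub_distrib]
    refine Finset.sum_congr rfl fun i _ => ?_
    rw [two_mul_sum_row_content, two_mul_sum_row_content]
    ring
  rw [hDn, zero_mul, zero_add, ← hdiff] at habel
  constructor <;> linarith
end

section
/- Let μ, l ≥ 1, s ≥ 0, 1 ≤ ρ ≤ μ, m ≥ 1 with gcd(m, μ+1) = 1. Let τ = (s(μ+1)+μ, μ, …, μ, ρ) (with l copies of μ), N = |τ| = (s+l+1)μ+s+ρ, κ₀ = −m/(μ+1), and let λ be Λ(μ,s,l,ρ,m) padded with zeros to N coordinates. For 1 ≤ v ≤ N let rw(v) be the unique row index with Σ_{i<rw(v)} τ_i < v ≤ Σ_{i≤rw(v)} τ_i and cm(v) = v − Σ_{i<rw(v)} τ_i (so value v occupies node (rw(v), cm(v)) in the row-by-row filling T₀ of the diagram of τ). Then for every 1 ≤ k ≤ N: N − k + λ_k/κ₀ = cm(N+1−k) − rw(N+1−k). -/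
open Finset

/-- The partition `τ = (s(μ+1)+μ, μ^l, ρ)` as a 1-based function, padded with zeros. -/
def tauF (μ s l ρ : ℕ) : ℕ → ℕ := fun i =>
  if i = 0 then 0
  else if i = 1 then s * (μ + 1) + μ
  else if i ≤ l + 1 then μ
  else if i = l + 2 then ρ
  else 0

/-- The number of nodes in the first `r + 1` rows of `τ`, when `r ≤ l`. -/
theorem sum_tauF_succ (μ s l ρ : ℕ) {r : ℕ} (hr : r ≤ l) :
    ∑ i ∈ Finset.Icc 1 (r + 1), tauF μ s l ρ i = s * (μ + 1) + (r + 1) * μ := by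
  induction r with
  | zero => simp [tauF]
  | succ r ih =>
    rw [Finset.sum_Icc_succ_top (by omega), ih (by omega)]
    have h : tauF μ s l ρ (r + 1 + 1) = μ := by
      simp only [tauF]
      rw [if_neg (by omega), if_neg (by omega), if_pos (by omega)]
    rw [h]
    ring

/-- The size of `τ`. -/
theorem sum_tauF_all (μ s l ρ : ℕ) :
    ∑ i ∈ Finset.Icc 1 (l + 2), tauF μ s l ρ i = (s + l + 1) * μ + s + ρ := by
  rw [Finset.sum_Icc_succ_top (by omega), sum_tauF_succ μ s l ρ le_rfl]
  have h : tauF μ s l ρ (l + 1 + 1) = ρ := by simp [tauF]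
  rw [h]
  ring

/-- The row of a value in a row-by-row filling is unique. -/
theorem row_le_of_sum_lt_of_le_sum (f : ℕ → ℕ) {v r r' : ℕ}
    (h : ∑ i ∈ Finset.Icc 1 (r - 1), f i < v) (h' : v ≤ ∑ i ∈ Finset.Icc 1 r', f i) :
    r ≤ r' := by
  by_contra! hlt
  have : ∑ i ∈ Finset.Icc 1 r', f i ≤ ∑ i ∈ Finset.Icc 1 (r - 1), f i :=
    Finset.sum_le_sum_of_subset (Finset.Icc_subset_Icc_right (by omega))
  omega

/-- Each part of `Λ` is `m * c`, where `c` is determined by the row of `τ` containing the value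
`N + 1 - k`. -/
theorem exists_row_of_Lam1 (μ s l ρ m : ℕ) (hμ : 1 ≤ μ) {k : ℕ} (hk : 1 ≤ k)
    (hkN : k ≤ (s + l + 1) * μ + s + ρ) :
    ∃ r c : ℕ, Lam1 μ s l ρ m k = m * c ∧
      ∑ i ∈ Finset.Icc 1 (r - 1), tauF μ s l ρ i < (s + l + 1) * μ + s + ρ + 1 - k ∧
      (s + l + 1) * μ + s + ρ + 1 - k ≤ ∑ i ∈ Finset.Icc 1 r, tauF μ s l ρ i ∧
      ∑ i ∈ Finset.Icc 1 (r - 1), tauF μ s l ρ i + r = 1 + (μ + 1) * c := by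
  have hN : (s + l + 1) * μ + s = s * (μ + 1) + (l + 1) * μ := by ring
  rcases le_or_gt k ρ with h1 | h1
  · refine ⟨l + 2, s + l + 1, ?_, ?_⟩
    · simp only [Lam1]
      rw [if_neg (by omega), if_pos h1]
    · rw [sum_tauF_all, show l + 2 - 1 = l + 1 by omega, sum_tauF_succ μ s l ρ le_rfl]
      exact ⟨by omega, by omega, by ring⟩
  rcases le_or_gt k (ρ + l * μ) with h2 | h2
  · obtain ⟨j, rfl⟩ : ∃ j, k = ρ + 1 + j := ⟨k - ρ - 1, by omega⟩
    have hq : j / μ < l := (Nat.div_lt_iff_lt_mul hμ).2 (by omega)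
    obtain ⟨d, hd⟩ : ∃ d, l = j / μ + d + 1 := ⟨l - j / μ - 1, by omega⟩
    have hdl : d + 1 ≤ l := by
      rw [hd, add_assoc]
      exact Nat.le_add_left _ _
    refine ⟨d + 2, s + d + 1, ?_, ?_⟩
    · simp only [Lam1]
      rw [if_neg (by omega), if_neg (by omega), if_pos h2,
        show ρ + 1 + j - ρ - 1 = j by omega, show s + l - j / μ = s + d + 1 by omega]
    · rw [show d + 2 - 1 = d + 1 by omega, sum_tauF_succ μ s l ρ (by omega : d ≤ l),
        sum_tauF_succ μ s l ρ hdl]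
      have hmod := Nat.div_add_mod j μ
      have hlt := Nat.mod_lt j hμ
      have hl : (l + 1) * μ = μ * (j / μ) + (d + 1) * μ + μ := by
        conv_lhs => rw [hd]
        ring
      have hd' : (d + 1 + 1) * μ = (d + 1) * μ + μ := by ring
      exact ⟨by omega, by omega, by ring⟩
  · refine ⟨1, 0, ?_, ?_⟩
    · simp only [Lam1]
      rw [if_neg (by omega), if_neg (by omega), if_neg (by omega), mul_zero]
    · have hs := sum_tauF_succ μ s l ρ (Nat.zero_le l)
      have hl : (l + 1) * μ = l * μ + μ := by ring
      simp only [zero_add, one_mul] at hs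
      rw [hs]
      simp only [Nat.sub_self, Finset.Icc_eq_empty_of_lt Nat.zero_lt_one, Finset.sum_empty]
      exact ⟨by omega, by omega, by omega⟩

/-- for `λ = Λ(μ,s,l,ρ,m)` (padded to `N` coordinates),
`κ₀ = -m/(μ+1)`, and `rw, cm` describing the row-by-row filling `T₀` of the
diagram of `τ = (s(μ+1)+μ, μ^l, ρ)`, one has
`N - k + λ_k/κ₀ = cm(N+1-k) - rw(N+1-k)` for all `1 ≤ k ≤ N`. -/
theorem eigenvalue_is_content (μ s l ρ m : ℕ)
    (hμ : 1 ≤ μ) (hl : 1 ≤ l) (hρ1 : 1 ≤ ρ) (hρμ : ρ ≤ μ) (hm : 1 ≤ m)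
    (hgcd : Nat.gcd m (μ + 1) = 1)
    (N : ℕ) (hN : N = (s + l + 1) * μ + s + ρ)
    (κ₀ : ℚ) (hκ : κ₀ = -(m : ℚ) / (μ + 1))
    (rw cm : ℕ → ℕ)
    (hrw : ∀ v ∈ Finset.Icc 1 N,
      (∑ i ∈ Finset.Icc 1 (rw v - 1), tauF μ s l ρ i) < v ∧
        v ≤ ∑ i ∈ Finset.Icc 1 (rw v), tauF μ s l ρ i)
    (hcm : ∀ v ∈ Finset.Icc 1 N,
      cm v = v - ∑ i ∈ Finset.Icc 1 (rw v - 1), tauF μ s l ρ i) :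
    ∀ k ∈ Finset.Icc 1 N,
      (N : ℚ) - (k : ℚ) + (Lam1 μ s l ρ m k : ℚ) / κ₀ =
        (cm (N + 1 - k) : ℚ) - (rw (N + 1 - k) : ℚ) := by
  intro k hk
  rw [Finset.mem_Icc] at hk
  have hv : N + 1 - k ∈ Finset.Icc 1 N := Finset.mem_Icc.2 (by omega)
  obtain ⟨r, c, hc, hr, hr', hrc⟩ := exists_row_of_Lam1 μ s l ρ m hμ hk.1 (hN ▸ hk.2)
  rw [← hN] at hr hr'
  obtain ⟨hw, hw'⟩ := hrw _ hv
  have hrow : rw (N + 1 - k) = r :=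
    le_antisymm (row_le_of_sum_lt_of_le_sum _ hw hr') (row_le_of_sum_lt_of_le_sum _ hr hw')
  have hm0 : (m : ℚ) ≠ 0 := by positivity
  have hdiv : (Lam1 μ s l ρ m k : ℚ) / κ₀ = -((μ + 1) * c) := by
    rw [hc, hκ]
    push_cast
    field_simp
  rw [hcm _ hv, hdiv, hrow, Nat.cast_sub hr.le, Nat.cast_sub (by omega : k ≤ N + 1)]
  have hrc' := congrArg (Nat.cast : ℕ → ℚ) hrc
  push_cast at hrc' ⊢
  linarith
end
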